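/- arXiv:1006.1168 — 3 statements merged into one kernel-verified Lean document; each statement's English description precedes it below -/
import Mathlib

section
/- Let m ≥ 1, let A_b^{αβ} : B̄₂ → ℂ^{m×m} be bounded measurable coefficients and A_c = F_*A_b on B₂ \ B̄₁. For y ∈ B₂ \ B̄₁ write ŷ = y/|y| = (ŷ₁, ŷ₂), let 𝟏_m ∈ ℝ^m be the vector with all entries 1, and set ξ_l = ŷ_l·𝟏_m ∈ ℝ^m for l = 1,2. Then Σ_{p,q=1}^2 [A_c^{pq}(y) ξ_q]* ξ_p = ((|y|−1)/|y|)·Σ_{p,q=1}^2 [A_b^{pq}(F⁻¹(y)) ξ_q]* ξ_p. -/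
noncomputable section
open Metric Matrix

/-- The blow-up map `F(x) = (1 + |x|/2) x/|x|`. -/
def Fmap (x : EuclideanSpace ℝ (Fin 2)) : EuclideanSpace ℝ (Fin 2) :=
  ((1 + ‖x‖ / 2) * ‖x‖⁻¹) • x

/-- Its inverse `y ↦ 2(|y| - 1) y/|y|` on `B₂ \ B̄₁`. -/
def Gmap (y : EuclideanSpace ℝ (Fin 2)) : EuclideanSpace ℝ (Fin 2) :=
  ((2 * (‖y‖ - 1)) * ‖y‖⁻¹) • y

/-- Standard basis vectors of `ℝ²`. -/
def eb (i : Fin 2) : EuclideanSpace ℝ (Fin 2) := EuclideanSpace.single i 1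

/-- Jacobian determinant `det [∂F_i/∂x_j]` of a map `F : ℝ² → ℝ²`. -/
def Jdet (F : EuclideanSpace ℝ (Fin 2) → EuclideanSpace ℝ (Fin 2))
    (x : EuclideanSpace ℝ (Fin 2)) : ℝ :=
  Matrix.det (Matrix.of fun i j => fderiv ℝ (fun z => F z i) x (eb j))

/-- Push-forward of the matrix coefficients `A = [A^{αβ}]` under `F` (with inverse `Finv`). -/
def pushA {m : ℕ} (F Finv : EuclideanSpace ℝ (Fin 2) → EuclideanSpace ℝ (Fin 2))
    (A : Fin 2 → Fin 2 → EuclideanSpace ℝ (Fin 2) → Matrix (Fin m) (Fin m) ℂ)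
    (p q : Fin 2) (y : EuclideanSpace ℝ (Fin 2)) : Matrix (Fin m) (Fin m) ℂ :=
  ∑ α : Fin 2, ∑ β : Fin 2,
    ((fderiv ℝ (fun z => F z p) (Finv y) (eb β) *
        fderiv ℝ (fun z => F z q) (Finv y) (eb α) * (Jdet F (Finv y))⁻¹ : ℝ)) •
      A α β (Finv y)

theorem hasFDerivAt_norm_aux (x : EuclideanSpace ℝ (Fin 2)) (hx : x ≠ 0) :
    HasFDerivAt (fun z : EuclideanSpace ℝ (Fin 2) => ‖z‖) (‖x‖⁻¹ • innerSL ℝ x) x := by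
  have hn : ‖x‖ ≠ 0 := norm_ne_zero_iff.mpr hx
  have h := (hasStrictFDerivAt_norm_sq x).hasFDerivAt.sqrt (pow_ne_zero 2 hn)
  have e : (fun z : EuclideanSpace ℝ (Fin 2) => √(‖z‖ ^ 2)) = fun z => ‖z‖ := by
    funext z; exact Real.sqrt_sq (norm_nonneg z)
  rw [e, Real.sqrt_sq (norm_nonneg x)] at h
  have e2 : (1 / (2 * ‖x‖)) • 2 • innerSL ℝ x = ‖x‖⁻¹ • innerSL ℝ x := by
    rw [← Nat.cast_smul_eq_nsmul ℝ, smul_smul]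
    congr 1
    push_cast
    field_simp
  rw [e2] at h
  exact h

theorem fderiv_Fmap_aux (x : EuclideanSpace ℝ (Fin 2)) (hx : x ≠ 0) (i j : Fin 2) :
    fderiv ℝ (fun z => Fmap z i) x (eb j) =
      (‖x‖⁻¹ + 1 / 2) * (if i = j then 1 else 0) - x i * x j * ‖x‖⁻¹ ^ 3 := by
  have hn : ‖x‖ ≠ 0 := norm_ne_zero_iff.mpr hx
  have h1 := hasFDerivAt_norm_aux x hx
  have h2 : HasFDerivAt (fun z : EuclideanSpace ℝ (Fin 2) => z i)
      (EuclideanSpace.proj i : EuclideanSpace ℝ (Fin 2) →L[ℝ] ℝ) x :=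
    (EuclideanSpace.proj i : EuclideanSpace ℝ (Fin 2) →L[ℝ] ℝ).hasFDerivAt
  have h3 := (hasDerivAt_inv hn).comp_hasFDerivAt x h1
  have h4 := (h3.add_const (1 / 2 : ℝ)).mul h2
  have e : (fun z => Fmap z i) =ᶠ[nhds x]
      fun z : EuclideanSpace ℝ (Fin 2) => (‖z‖⁻¹ + 1 / 2) * z i := by
    filter_upwards [isOpen_ne.mem_nhds hx] with z hz
    have : ‖z‖ ≠ 0 := norm_ne_zero_iff.mpr hz
    simp only [Fmap, PiLp.smul_apply, smul_eq_mul]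
    field_simp
  have h5 := h4.congr_of_eventuallyEq e
  rw [h5.fderiv]
  have hinner : inner ℝ x (eb j) = x j := by
    simp [eb, EuclideanSpace.inner_single_right]
  have hp : (eb j) i = if i = j then (1 : ℝ) else 0 := by
    simp [eb, Pi.single_apply]
  simp [hinner, hp]
  ring

theorem quad_aux {m : ℕ} (A : Matrix (Fin m) (Fin m) ℂ) (ξ η : Fin m → ℂ) (a b : ℝ)
    (h1 : ∀ p, ξ p = (a : ℂ)) (h2 : ∀ p, η p = (b : ℂ)) :
    star (A.mulVec ξ) ⬝ᵥ η = (a : ℂ) * b * ∑ i, ∑ j, star (A i j) := by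
  simp only [dotProduct, Matrix.mulVec, Pi.star_apply, h1, h2, star_sum, star_mul',
    Finset.sum_mul, Finset.mul_sum]
  refine Finset.sum_congr rfl fun i _ => Finset.sum_congr rfl fun j _ => ?_
  simp
  ring

/-- for the radial vectors `ξ_l = ŷ_l 𝟏_m`, the quadratic form of
`A_c = F_*A_b` satisfies
`Σ_{p,q} [A_c^{pq}(y) ξ_q]* ξ_p = ((|y|−1)/|y|) Σ_{p,q} [A_b^{pq}(F⁻¹(y)) ξ_q]* ξ_p`. -/
theorem stmt_6 {m : ℕ} (hm : 1 ≤ m)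
    (Ab : Fin 2 → Fin 2 → EuclideanSpace ℝ (Fin 2) → Matrix (Fin m) (Fin m) ℂ)
    (hAmeas : ∀ α β p q, Measurable fun x => Ab α β x p q)
    (M : ℝ) (hAbd : ∀ α β x p q, ‖Ab α β x p q‖ ≤ M)
    (y : EuclideanSpace ℝ (Fin 2))
    (hy : y ∈ ball (0 : EuclideanSpace ℝ (Fin 2)) 2 \ closedBall 0 1)
    (ξ : Fin 2 → Fin m → ℂ) (hξ : ∀ l p, ξ l p = ((y l / ‖y‖ : ℝ) : ℂ)) :
    ∑ p : Fin 2, ∑ q : Fin 2, star ((pushA Fmap Gmap Ab p q y).mulVec (ξ q)) ⬝ᵥ ξ p =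
      (((‖y‖ - 1) / ‖y‖ : ℝ) : ℂ) *
        ∑ p : Fin 2, ∑ q : Fin 2, star ((Ab p q (Gmap y)).mulVec (ξ q)) ⬝ᵥ ξ p := by
  obtain ⟨hy2, hy1⟩ := hy
  have hs : 1 < ‖y‖ := by simpa using hy1
  have hs0 : ‖y‖ ≠ 0 := by positivity
  have hs1 : ‖y‖ - 1 ≠ 0 := by linarith
  have hG : ‖Gmap y‖ = 2 * (‖y‖ - 1) := by
    rw [Gmap, norm_smul, Real.norm_of_nonneg (by
      have : 0 ≤ ‖y‖ - 1 := by linarith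
      positivity)]
    field_simp
  have hGx : Gmap y ≠ 0 := by
    rw [← norm_ne_zero_iff, hG]; simpa using hs1
  obtain ⟨v, hv⟩ : ∃ v : Fin 2 → ℝ, ∀ l, v l = y l / ‖y‖ := ⟨_, fun _ => rfl⟩
  have hv1 : v 0 ^ 2 + v 1 ^ 2 = 1 := by
    have := EuclideanSpace.norm_sq_eq y
    simp [Fin.sum_univ_two] at this
    rw [hv, hv, div_pow, div_pow, ← add_div, ← this]
    field_simp
  have hGv : ∀ l, Gmap y l = 2 * (‖y‖ - 1) * v l := by
    intro l; simp only [Gmap, PiLp.smul_apply, smul_eq_mul, hv]; ring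
  obtain ⟨c, hc⟩ : ∃ c : ℝ, c = (2 * (‖y‖ - 1))⁻¹ := ⟨_, rfl⟩
  have hD : ∀ i j, fderiv ℝ (fun z => Fmap z i) (Gmap y) (eb j) =
      (c + 1 / 2) * (if i = j then 1 else 0) - c * (v i * v j) := by
    intro i j
    rw [fderiv_Fmap_aux _ hGx, hG, hGv, hGv, hc]
    field_simp
  have hJ : Jdet Fmap (Gmap y) = (c + 1 / 2) / 2 := by
    simp only [Jdet, Matrix.det_fin_two, Matrix.of_apply, hD]
    simp
    linear_combination (-(c + 1 / 2) * c) * hv1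
  have hJ' : (Jdet Fmap (Gmap y))⁻¹ = 4 * ((‖y‖ - 1) / ‖y‖) := by
    rw [hJ, hc]
    have : (2 * (‖y‖ - 1))⁻¹ + 1 / 2 = ‖y‖ / (2 * (‖y‖ - 1)) := by field_simp; ring
    rw [this]; field_simp; norm_num
  have hξ' : ∀ l p, ξ l p = (v l : ℂ) := fun l p => by rw [hξ, hv]
  have hq : ∀ (A : Matrix (Fin m) (Fin m) ℂ) (p q : Fin 2), star (A.mulVec (ξ q)) ⬝ᵥ ξ p =
      (v q : ℂ) * v p * ∑ i, ∑ j, star (A i j) :=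
    fun A p q => quad_aux A _ _ _ _ (hξ' q) (hξ' p)
  simp only [hq]
  obtain ⟨S, hS⟩ : ∃ S : Fin 2 → Fin 2 → ℂ,
      ∀ p q, S p q = ∑ i, ∑ j, star (Ab p q (Gmap y) i j) := ⟨_, fun _ _ => rfl⟩
  have hP : ∀ p q, ∑ i, ∑ j, star (pushA Fmap Gmap Ab p q y i j) =
      ∑ α, ∑ β, ((((c + 1 / 2) * (if p = β then 1 else 0) - c * (v p * v β)) *
        ((c + 1 / 2) * (if q = α then 1 else 0) - c * (v q * v α)) *
        (4 * ((‖y‖ - 1) / ‖y‖)) : ℝ) : ℂ) * S α β := by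
    intro p q
    have hstar : ∀ r : ℝ, star (r : ℂ) = r := fun r => Complex.conj_ofReal r
    simp only [pushA, hD, hJ', hS]
    simp only [Fin.sum_univ_two, Matrix.add_apply, Matrix.smul_apply, star_add,
      Finset.sum_add_distrib, Complex.real_smul, star_mul', hstar, ← Finset.mul_sum]
  simp only [hP, ← hS]
  generalize (‖y‖ - 1) / ‖y‖ = k
  have hv1c : (v 0 : ℂ) ^ 2 + (v 1 : ℂ) ^ 2 = 1 := by exact_mod_cast hv1
  have hw : ∀ β : Fin 2, ∑ p : Fin 2, (v p : ℂ) *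
      (((c + 1 / 2) * (if p = β then 1 else 0) - c * (v p * v β) : ℝ) : ℂ) = v β / 2 := by
    intro β
    fin_cases β
    · simp [Fin.sum_univ_two]
      linear_combination (-(c : ℂ) * v 0) * hv1c
    · simp [Fin.sum_univ_two]
      linear_combination (-(c : ℂ) * v 1) * hv1c
  generalize hE : (fun p β : Fin 2 => (c + 1 / 2) * (if p = β then 1 else 0) - c * (v p * v β)) = E
  have hE' : ∀ p β : Fin 2,
    (c + 1 / 2) * (if p = β then 1 else 0) - c * (v p * v β) = E p β := fun p β => by rw [← hE]
  simp only [hE'] at hw ⊢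
  have h0 := hw 0
  have h1 := hw 1
  simp only [Fin.sum_univ_two] at h0 h1 ⊢
  push_cast
  have g : ∀ a b d e : ℂ, a = d / 2 → b = e / 2 → 4 * (a * b) = d * e := by
    rintro a b d e rfl rfl; ring
  have g00 := g _ _ _ _ h0 h0
  have g01 := g _ _ _ _ h0 h1
  have g11 := g _ _ _ _ h1 h1
  linear_combination (k : ℂ) * S 0 0 * g00 + k * (S 0 1 + S 1 0) * g01 + k * S 1 1 * g11
end
end

section
/- Let m ≥ 1, let A_b^{αβ} : B̄₂ → ℂ^{m×m} be bounded measurable coefficients and A_c = F_*A_b on B₂ \ B̄₁. For y ∈ B₂ \ B̄₁ write ŷ = y/|y|, let ŷ^⊥ = (ŷ₁^⊥, ŷ₂^⊥) ∈ S₁ be a unit vector with ŷ·ŷ^⊥ = 0, let 𝟏_m ∈ ℝ^m be the vector with all entries 1, and set ξ_l^⊥ = ŷ_l^⊥·𝟏_m ∈ ℝ^m for l = 1,2. Then Σ_{p,q=1}^2 [A_c^{pq}(y) ξ_q^⊥]* ξ_p^⊥ = (|y|/(|y|−1))·Σ_{p,q=1}^2 [A_b^{pq}(F⁻¹(y)) ξ_q^⊥]*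 ξ_p^⊥. -/
noncomputable section
open Metric Matrix

theorem Fmap_fderiv (x : EuclideanSpace ℝ (Fin 2)) (hx : x ≠ 0) (p b : Fin 2) :
    fderiv ℝ (fun z => Fmap z p) x (eb b) =
      (‖x‖⁻¹ + 1 / 2) * (if p = b then 1 else 0) - x p * x b / ‖x‖ ^ 3 := by
  have hr : ‖x‖ ≠ 0 := norm_ne_zero_iff.mpr hx
  have h1 : HasFDerivAt (fun z : EuclideanSpace ℝ (Fin 2) => ‖z‖ ^ 2) (2 • (innerSL ℝ x)) x :=
    (hasStrictFDerivAt_norm_sq x).hasFDerivAt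
  have h2 := h1.sqrt (by positivity)
  have h3 : HasFDerivAt (fun z : EuclideanSpace ℝ (Fin 2) => ‖z‖) (‖x‖⁻¹ • innerSL ℝ x) x := by
    have e : (fun z : EuclideanSpace ℝ (Fin 2) => √(‖z‖ ^ 2)) = fun z => ‖z‖ := by
      funext z; exact Real.sqrt_sq (norm_nonneg z)
    rw [e, Real.sqrt_sq (norm_nonneg x)] at h2
    refine h2.congr_fderiv ?_
    ext v
    simp
    field_simp
  have h4 : HasFDerivAt (fun z : EuclideanSpace ℝ (Fin 2) => ‖z‖⁻¹)
      ((-(‖x‖ ^ 2)⁻¹) • (‖x‖⁻¹ • innerSL ℝ x)) x :=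
    (hasDerivAt_inv hr).comp_hasFDerivAt x h3
  have h5 : HasFDerivAt (fun z : EuclideanSpace ℝ (Fin 2) => z p)
      (EuclideanSpace.proj p : EuclideanSpace ℝ (Fin 2) →L[ℝ] ℝ) x :=
    (EuclideanSpace.proj p : EuclideanSpace ℝ (Fin 2) →L[ℝ] ℝ).hasFDerivAt
  have h6 := (((h3.mul_const (2⁻¹ : ℝ)).const_add 1).mul h4).mul h5
  have h7 : (fun z => Fmap z p) = (fun z : EuclideanSpace ℝ (Fin 2) =>
      ((1 + ‖z‖ * 2⁻¹) * ‖z‖⁻¹) * z p) := by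
    funext z
    simp [Fmap, div_eq_mul_inv]
  rw [h7]
  erw [h6.fderiv]
  have e1 : (inner ℝ x (eb b) : ℝ) = x b := by
    simp [eb, EuclideanSpace.inner_single_right]
  have e2 : (eb b) p = if p = b then (1:ℝ) else 0 := by
    simp [eb, Pi.single_apply]
  simp [e1, e2]
  split_ifs <;> field_simp <;> ring

theorem form_smul {m : ℕ} (A : Matrix (Fin m) (Fin m) ℂ) (a b : ℝ) (u v : Fin m → ℂ)
    (hu : ∀ i, u i = (a : ℂ)) (hv : ∀ i, v i = (b : ℂ)) :
    star (A.mulVec u) ⬝ᵥ v = (a : ℂ) * b * ∑ i, ∑ j, star (A i j) := by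
  simp only [dotProduct, Matrix.mulVec, Pi.star_apply, hu, hv, star_sum, star_mul',
    Finset.mul_sum, Finset.sum_mul]
  refine Finset.sum_congr rfl fun i _ => Finset.sum_congr rfl fun j _ => ?_
  simp
  ring

/-- for the tangential vectors `ξ_l^⊥ = ŷ_l^⊥ 𝟏_m`, where `ŷ^⊥` is a unit
vector orthogonal to `ŷ = y/|y|`, the quadratic form of `A_c = F_*A_b` satisfies
`Σ_{p,q} [A_c^{pq}(y) ξ_q^⊥]* ξ_p^⊥ = (|y|/(|y|−1)) Σ_{p,q} [A_b^{pq}(F⁻¹(y)) ξ_q^⊥]* ξ_p^⊥`. -/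
theorem stmt_7 {m : ℕ} (hm : 1 ≤ m)
    (Ab : Fin 2 → Fin 2 → EuclideanSpace ℝ (Fin 2) → Matrix (Fin m) (Fin m) ℂ)
    (hAmeas : ∀ α β p q, Measurable fun x => Ab α β x p q)
    (M : ℝ) (hAbd : ∀ α β x p q, ‖Ab α β x p q‖ ≤ M)
    (y : EuclideanSpace ℝ (Fin 2))
    (hy : y ∈ ball (0 : EuclideanSpace ℝ (Fin 2)) 2 \ closedBall 0 1)
    (w : EuclideanSpace ℝ (Fin 2)) (hw : ‖w‖ = 1)
    (horth : inner (𝕜 := ℝ) (‖y‖⁻¹ • y) w = (0 : ℝ))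
    (ξ : Fin 2 → Fin m → ℂ) (hξ : ∀ l p, ξ l p = ((w l : ℝ) : ℂ)) :
    ∑ p : Fin 2, ∑ q : Fin 2, star ((pushA Fmap Gmap Ab p q y).mulVec (ξ q)) ⬝ᵥ ξ p =
      ((‖y‖ / (‖y‖ - 1) : ℝ) : ℂ) *
        ∑ p : Fin 2, ∑ q : Fin 2, star ((Ab p q (Gmap y)).mulVec (ξ q)) ⬝ᵥ ξ p := by
  obtain ⟨hy2, hy1⟩ := hy
  have hρ : 1 < ‖y‖ := by simpa using hy1
  have hρ0 : ‖y‖ ≠ 0 := by positivity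
  have hρ1 : ‖y‖ - 1 ≠ 0 := by linarith
  have hxn : ‖Gmap y‖ = 2 * (‖y‖ - 1) := by
    rw [Gmap, norm_smul, Real.norm_of_nonneg]
    · field_simp
    · have : 0 ≤ ‖y‖ - 1 := by linarith
      positivity
  have hx0 : Gmap y ≠ 0 := by
    rw [← norm_ne_zero_iff, hxn]
    exact mul_ne_zero two_ne_zero hρ1
  have horth' : Gmap y 0 * w 0 + Gmap y 1 * w 1 = 0 := by
    rw [inner_smul_left] at horth
    have h : (inner ℝ y w : ℝ) = 0 := by simpa [hρ0] using horth
    simp [PiLp.inner_apply, Fin.sum_univ_two] at h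
    simp [Gmap]
    linear_combination (2 * (‖y‖ - 1) * ‖y‖⁻¹) * h
  have hsq : Gmap y 0 ^ 2 + Gmap y 1 ^ 2 = (2 * (‖y‖ - 1)) ^ 2 := by
    rw [← hxn, EuclideanSpace.norm_sq_eq]
    simp [Fin.sum_univ_two]
  have hD := Fmap_fderiv (Gmap y) hx0
  have hJ : Jdet Fmap (Gmap y) = ‖y‖ / (‖y‖ - 1) / 4 := by
    rw [Jdet, Matrix.det_fin_two]
    simp only [Matrix.of_apply, hD, hxn]
    simp
    field_simp
    linear_combination (-16 * ‖y‖ * (‖y‖ - 1) ^ 2) * hsq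
  have hT : ∀ b : Fin 2, w 0 * fderiv ℝ (fun z => Fmap z 0) (Gmap y) (eb b) +
      w 1 * fderiv ℝ (fun z => Fmap z 1) (Gmap y) (eb b) = ‖y‖ / (‖y‖ - 1) / 2 * w b := by
    intro b
    simp only [hD, hxn]
    fin_cases b
    · simp
      field_simp
      linear_combination (-Gmap y 0) * horth'
    · simp
      field_simp
      linear_combination (-Gmap y 1) * horth'
  have hS : ∀ p q, ∑ i, ∑ j, star (pushA Fmap Gmap Ab p q y i j) =
      ∑ α : Fin 2, ∑ β : Fin 2,
        ((fderiv ℝ (fun z => Fmap z p) (Gmap y) (eb β) *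
          fderiv ℝ (fun z => Fmap z q) (Gmap y) (eb α) * (Jdet Fmap (Gmap y))⁻¹ : ℝ) : ℂ) *
        ∑ i, ∑ j, star (Ab α β (Gmap y) i j) := by
    intro p q
    simp [pushA, Fin.sum_univ_two, Matrix.add_apply, Matrix.smul_apply, Finset.sum_add_distrib,
      Finset.mul_sum]
  simp only [fun p q => form_smul (pushA Fmap Gmap Ab p q y) (w q) (w p) (ξ q) (ξ p) (hξ q) (hξ p),
    fun p q => form_smul (Ab p q (Gmap y)) (w q) (w p) (ξ q) (ξ p) (hξ q) (hξ p), hS, hJ]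
  have key : ∀ (D : Fin 2 → Fin 2 → ℝ) (S : Fin 2 → Fin 2 → ℂ) (k : ℝ), k ≠ 0 →
      (∀ b, w 0 * D 0 b + w 1 * D 1 b = k / 2 * w b) →
      ∑ p : Fin 2, ∑ q : Fin 2, ((w q : ℂ) * (w p : ℂ) *
        ∑ α : Fin 2, ∑ β : Fin 2, ((D p β * D q α * (k / 4)⁻¹ : ℝ) : ℂ) * S α β) =
      (k : ℂ) * ∑ p : Fin 2, ∑ q : Fin 2, (w q : ℂ) * (w p : ℂ) * S p q := by
    intro D S k hk hb
    have hb' : ∀ b, (w 0 : ℂ) * D 0 b + w 1 * D 1 b = k / 2 * w b := by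
      intro b; exact_mod_cast hb b
    have hk' : (k : ℂ) ≠ 0 := by exact_mod_cast hk
    have h2 : ∀ α β, ((w 0 : ℂ) * D 0 β + w 1 * D 1 β) * (w 0 * D 0 α + w 1 * D 1 α) *
        ((k : ℂ) / 4)⁻¹ = k * (w β * w α) := by
      intro α β
      rw [hb', hb']
      field_simp
      ring
    simp only [Fin.sum_univ_two]
    push_cast
    linear_combination S 0 0 * h2 0 0 + S 0 1 * h2 0 1 + S 1 0 * h2 1 0 + S 1 1 * h2 1 1
  exact key (fun p b => fderiv ℝ (fun z => Fmap z p) (Gmap y) (eb b)) 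
    (fun α β => ∑ i, ∑ j, star (Ab α β (Gmap y) i j)) _ (div_ne_zero hρ0 hρ1) hT
end
end

section
/- Let m ≥ 1 and let A_b^{αβ} : B̄₂ → ℂ^{m×m} be bounded measurable coefficients satisfying the regularity bounds: there are constants 0 < c₁ < c₂ such that for all x and all ξ₁, ξ₂ ∈ ℂ^m, c₁(|ξ₁|²+|ξ₂|²) ≤ Re Σ_{α,β=1}^2 [A_b^{αβ}(x) ξ_β]* ξ_α ≤ c₂(|ξ₁|²+|ξ₂|²). Let A_c = F_*A_b on B₂ \ B̄₁. For y ∈ B₂ \ B̄₁ set ξ_l = ŷ_l·𝟏_m and ξ_l^⊥ = ŷ_l^⊥·𝟏_m (l = 1,2), where ŷ = y/|y|, ŷ^⊥ is a unit vector orthogonal to ŷ, and 𝟏_m is the all-ones vector in ℝ^m. Then as |y| → 1⁺ (i.e., along y ∈ B₂ \ B̄₁ with |y| → 1): Σ_{p,q=1}^2 [A_c^{pq}(y) ξ_q]* ξ_p → 0 and Re Σ_{p,q=1}^2 [A_c^{pq}(y) ξ_q^⊥]* ξ_p^⊥ → +∞. -/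
noncomputable section
open Metric Matrix Filter

/-- The radial unit vector `ξ_l = ŷ_l 𝟏_m`, as a `ℂ^m`-valued family. -/
def ξrad (m : ℕ) (y : EuclideanSpace ℝ (Fin 2)) : Fin 2 → Fin m → ℂ :=
  fun l _ => ((y l / ‖y‖ : ℝ) : ℂ)

/-- The tangential unit vector `ξ_l^⊥ = ŷ_l^⊥ 𝟏_m` with `ŷ^⊥ = (−ŷ₂, ŷ₁)`. -/
def ξtan (m : ℕ) (y : EuclideanSpace ℝ (Fin 2)) : Fin 2 → Fin m → ℂ :=
  fun l _ => if l = 0 then ((-(y 1) / ‖y‖ : ℝ) : ℂ) else ((y 0 / ‖y‖ : ℝ) : ℂ)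

/-- The filter of points `y ∈ B₂ \ B̄₁` with `|y| → 1⁺`. -/
def toS1plus : Filter (EuclideanSpace ℝ (Fin 2)) :=
  Filter.principal (ball (0 : EuclideanSpace ℝ (Fin 2)) 2 \ closedBall 0 1) ⊓
    Filter.comap (fun y => ‖y‖) (nhdsWithin 1 (Set.Ioi 1))

/-- The form of a coefficient block on the all-ones vector. -/
def aform {m : ℕ} (A : Matrix (Fin m) (Fin m) ℂ) : ℂ :=
  star (A.mulVec (fun _ => 1)) ⬝ᵥ (fun _ => 1)

lemma aform_real {m : ℕ} (A : Matrix (Fin m) (Fin m) ℂ) (s t : ℝ) :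
    star (A.mulVec (fun _ => (s : ℂ))) ⬝ᵥ (fun _ => (t : ℂ)) = s * t * aform A := by
  have h : ∀ u : ℝ, (fun _ : Fin m => (u : ℂ)) = (u : ℂ) • (fun _ => (1 : ℂ)) := by
    intro u; ext; simp
  rw [h s, h t, aform, mulVec_smul, star_smul, smul_dotProduct, dotProduct_smul]
  simp [mul_assoc]

lemma aform_add {m : ℕ} (A B : Matrix (Fin m) (Fin m) ℂ) : aform (A + B) = aform A + aform B := by
  simp [aform, add_mulVec, add_dotProduct]

lemma aform_smul {m : ℕ} (c : ℝ) (A : Matrix (Fin m) (Fin m) ℂ) :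
    aform (c • A) = c * aform A := by
  simp [aform, smul_mulVec, smul_dotProduct]

lemma aform_bound {m : ℕ} (A : Matrix (Fin m) (Fin m) ℂ) (M : ℝ) (h : ∀ p q, ‖A p q‖ ≤ M) :
    ‖aform A‖ ≤ m * (m * M) := by
  have : aform A = ∑ i, ∑ j, star (A i j) := by
    simp [aform, dotProduct, mulVec]
  rw [this]
  refine (norm_sum_le_of_le _ (f := fun i => ∑ j, star (A i j)) (n := fun _ => m * M) ?_).trans ?_
  · intro i _
    refine (norm_sum_le_of_le _ (n := fun _ => M) ?_).trans ?_
    · intro j _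
      simpa using h i j
    · simp
  · simp

lemma fderiv_Fmap (x : EuclideanSpace ℝ (Fin 2)) (hx : x ≠ 0) (i j : Fin 2) :
    fderiv ℝ (fun z => Fmap z i) x (eb j) =
      (‖x‖⁻¹ + 1 / 2) * (if i = j then 1 else 0) - x i * x j / ‖x‖ ^ 3 := by
  have hn : ‖x‖ ≠ 0 := norm_ne_zero_iff.mpr hx
  have hN : HasFDerivAt (fun z : EuclideanSpace ℝ (Fin 2) => ‖z‖) (‖x‖⁻¹ • innerSL ℝ x) x := by
    have h := (hasStrictFDerivAt_norm_sq x).hasFDerivAt.sqrt (pow_ne_zero 2 hn)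
    simp only [Real.sqrt_sq (norm_nonneg _)] at h
    rw [← Nat.cast_smul_eq_nsmul ℝ, smul_smul] at h
    have hk : 1 / (2 * ‖x‖) * ((2 : ℕ) : ℝ) = ‖x‖⁻¹ := by
      push_cast
      field_simp
    rw [hk] at h
    exact h
  have hI : HasFDerivAt (fun z : EuclideanSpace ℝ (Fin 2) => ‖z‖⁻¹)
      ((-(‖x‖ ^ 2)⁻¹) • (‖x‖⁻¹ • innerSL ℝ x)) x :=
    (hasDerivAt_inv hn).comp_hasFDerivAt x hN
  have hc : HasFDerivAt (fun z : EuclideanSpace ℝ (Fin 2) => z i)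
      (EuclideanSpace.proj (𝕜 := ℝ) i : EuclideanSpace ℝ (Fin 2) →L[ℝ] ℝ) x :=
    (EuclideanSpace.proj (𝕜 := ℝ) i : EuclideanSpace ℝ (Fin 2) →L[ℝ] ℝ).hasFDerivAt
  have hF := (((hN.mul_const (1 / 2)).const_add 1).mul hI).mul hc
  have he : (fun z : EuclideanSpace ℝ (Fin 2) => Fmap z i) =
      fun z => (1 + ‖z‖ * (1 / 2)) * ‖z‖⁻¹ * z i := by
    ext z; simp [Fmap, div_eq_mul_inv]
  rw [he]
  refine (congrArg (fun L => L (eb j)) hF.fderiv).trans ?_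
  have h1 : inner ℝ x (eb j) = x j := by simp [eb, EuclideanSpace.inner_single_right]
  have h2 : (eb j) i = if i = j then (1 : ℝ) else 0 := by simp [eb, Pi.single_apply]
  simp [h1, h2]
  field_simp
  ring

lemma norm_sq_two (y : EuclideanSpace ℝ (Fin 2)) : y 0 ^ 2 + y 1 ^ 2 = ‖y‖ ^ 2 := by
  simp [EuclideanSpace.norm_sq_eq, Fin.sum_univ_two]

/-- Derivative matrix at `Gmap y`. -/
lemma fderiv_at (y : EuclideanSpace ℝ (Fin 2)) (hy : 1 < ‖y‖) (i j : Fin 2) :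
    fderiv ℝ (fun z => Fmap z i) (Gmap y) (eb j) =
      ((2 * (‖y‖ - 1))⁻¹ + 1 / 2) * (if i = j then 1 else 0)
        - (2 * (‖y‖ - 1))⁻¹ * ((y i / ‖y‖) * (y j / ‖y‖)) := by
  have h0 : 0 < ‖y‖ := by linarith
  have h1 : 0 < ‖y‖ - 1 := by linarith
  have hG : ‖Gmap y‖ = 2 * (‖y‖ - 1) := by
    rw [Gmap, norm_smul, Real.norm_of_nonneg (by positivity)]
    field_simp
  have hne : Gmap y ≠ 0 := by
    rw [← norm_ne_zero_iff, hG]; positivity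
  rw [fderiv_Fmap _ hne, hG]
  have hc : ∀ k, Gmap y k = 2 * (‖y‖ - 1) * ‖y‖⁻¹ * y k := fun k => by simp [Gmap]
  rw [hc, hc]
  congr 1
  field_simp

lemma Jdet_at (y : EuclideanSpace ℝ (Fin 2)) (hy : 1 < ‖y‖) :
    Jdet Fmap (Gmap y) = ((2 * (‖y‖ - 1))⁻¹ + 1 / 2) / 2 := by
  have h0 : ‖y‖ ≠ 0 := by linarith
  have hs : (y 0 / ‖y‖) ^ 2 + (y 1 / ‖y‖) ^ 2 = 1 := by
    have := norm_sq_two y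
    field_simp
    exact this
  simp only [Jdet, det_fin_two, of_apply, fderiv_at y hy]
  simp
  generalize y 0 / ‖y‖ = a at *
  generalize y 1 / ‖y‖ = b at *
  generalize (‖y‖ - 1)⁻¹ = r at *
  have hb : b ^ 2 = 1 - a ^ 2 := by linarith
  ring_nf
  rw [hb]
  ring

lemma push_form {m : ℕ}
    (A : Fin 2 → Fin 2 → EuclideanSpace ℝ (Fin 2) → Matrix (Fin m) (Fin m) ℂ)
    (y : EuclideanSpace ℝ (Fin 2)) (s η : Fin 2 → ℝ)
    (hη : ∀ j, ∑ p, fderiv ℝ (fun z => Fmap z p) (Gmap y) (eb j) * s p = η j) :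
    ∑ p : Fin 2, ∑ q : Fin 2,
      star ((pushA Fmap Gmap A p q y).mulVec (fun _ => (s q : ℂ))) ⬝ᵥ (fun _ => (s p : ℂ)) =
    ((Jdet Fmap (Gmap y))⁻¹ : ℝ) * ∑ α : Fin 2, ∑ β : Fin 2, (η α * η β : ℝ) *
      aform (A α β (Gmap y)) := by
  simp only [aform_real, pushA, Fin.sum_univ_two, aform_add, aform_smul, ← hη]
  push_cast
  ring

/-- The form on real multiples of the all-ones vector. -/
lemma form_real {m : ℕ}
    (A : Fin 2 → Fin 2 → EuclideanSpace ℝ (Fin 2) → Matrix (Fin m) (Fin m) ℂ)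
    (x : EuclideanSpace ℝ (Fin 2)) (s : Fin 2 → ℝ) :
    ∑ α : Fin 2, ∑ β : Fin 2, star ((A α β x).mulVec (fun _ => (s β : ℂ))) ⬝ᵥ
      (fun _ => (s α : ℂ)) =
    ∑ α : Fin 2, ∑ β : Fin 2, (s α * s β : ℝ) * aform (A α β x) := by
  simp only [aform_real]
  push_cast
  simp only [mul_comm, mul_left_comm]

/-- Tangential unit vector. -/
def tvec (y : EuclideanSpace ℝ (Fin 2)) : Fin 2 → ℝ :=
  fun l => if l = 0 then -(y 1) / ‖y‖ else y 0 / ‖y‖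

lemma hat_sq (y : EuclideanSpace ℝ (Fin 2)) (hy : 1 < ‖y‖) :
    (y 0 / ‖y‖) ^ 2 + (y 1 / ‖y‖) ^ 2 = 1 := by
  have h0 : ‖y‖ ≠ 0 := by linarith
  have := norm_sq_two y
  field_simp
  exact this

lemma rad_form {m : ℕ}
    (A : Fin 2 → Fin 2 → EuclideanSpace ℝ (Fin 2) → Matrix (Fin m) (Fin m) ℂ)
    (y : EuclideanSpace ℝ (Fin 2)) (hy : 1 < ‖y‖) :
    ∑ p : Fin 2, ∑ q : Fin 2,
          star ((pushA Fmap Gmap A p q y).mulVec (ξrad m y q)) ⬝ᵥ ξrad m y p =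
    (((‖y‖ - 1) / ‖y‖ : ℝ) : ℂ) * ∑ α : Fin 2, ∑ β : Fin 2,
      ((y α / ‖y‖) * (y β / ‖y‖) : ℝ) * aform (A α β (Gmap y)) := by
  have hs := hat_sq y hy
  refine (push_form A y (fun l => y l / ‖y‖) (fun l => (1 / 2) * (y l / ‖y‖)) ?_).trans ?_
  · intro j
    simp only [fderiv_at y hy, Fin.sum_univ_two]
    fin_cases j <;> simp <;>
    generalize y 0 / ‖y‖ = a at * <;>
    generalize y 1 / ‖y‖ = b at * <;>
    generalize (‖y‖ - 1)⁻¹ = r at *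
    · linear_combination (-(r * 2⁻¹ * a)) * hs
    · linear_combination (-(r * 2⁻¹ * b)) * hs
  · have h1 : (Jdet Fmap (Gmap y))⁻¹ = 4 * ((‖y‖ - 1) / ‖y‖) := by
      rw [Jdet_at y hy]
      have h0 : ‖y‖ ≠ 0 := by linarith
      have h1 : ‖y‖ - 1 ≠ 0 := by linarith
      have h3 : (2 * (‖y‖ - 1))⁻¹ + 1 / 2 = ‖y‖ / (2 * (‖y‖ - 1)) := by field_simp; ring
      rw [h3]
      field_simp
      norm_num
    rw [h1]
    simp only [Fin.sum_univ_two]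
    push_cast
    ring

lemma tan_form {m : ℕ}
    (A : Fin 2 → Fin 2 → EuclideanSpace ℝ (Fin 2) → Matrix (Fin m) (Fin m) ℂ)
    (y : EuclideanSpace ℝ (Fin 2)) (hy : 1 < ‖y‖) :
    ∑ p : Fin 2, ∑ q : Fin 2,
          star ((pushA Fmap Gmap A p q y).mulVec (ξtan m y q)) ⬝ᵥ ξtan m y p =
    ((((‖y‖ - 1)⁻¹ + 1 : ℝ)) : ℂ) * ∑ α : Fin 2, ∑ β : Fin 2,
      (tvec y α * tvec y β : ℝ) * aform (A α β (Gmap y)) := by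
  have hs := hat_sq y hy
  have hξ : ξtan m y = fun l _ => ((tvec y l : ℝ) : ℂ) := by
    ext l k; simp only [ξtan, tvec]; split_ifs <;> rfl
  rw [hξ]
  refine (push_form A y (tvec y)
    (fun l => ((2 * (‖y‖ - 1))⁻¹ + 1 / 2) * tvec y l) ?_).trans ?_
  · intro j
    simp only [fderiv_at y hy, Fin.sum_univ_two, tvec]
    fin_cases j <;> simp <;> ring
  · rw [Jdet_at y hy]
    have h1 : 0 < (‖y‖ - 1)⁻¹ := inv_pos.mpr (by linarith)
    have h2 : (2 * (‖y‖ - 1))⁻¹ + 1 / 2 = ((‖y‖ - 1)⁻¹ + 1) / 2 := by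
      rw [mul_inv]; ring
    rw [h2]
    generalize (‖y‖ - 1)⁻¹ = r at *
    have h3 : (r : ℂ) + 1 ≠ 0 := by
      exact_mod_cast (by linarith : r + 1 ≠ 0)
    simp only [Fin.sum_univ_two]
    push_cast
    field_simp

/-- for a regular background coefficient `A_b`, the quadratic form of the
cloaking coefficient `A_c = F_*A_b` degenerates in the radial direction
(`Σ [A_c ξ]*ξ → 0`) and blows up in the tangential direction
(`Re Σ [A_c ξ^⊥]*ξ^⊥ → +∞`) as `|y| → 1⁺`. -/
theorem stmt_8 {m : ℕ} (hm : 1 ≤ m)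
    (Ab : Fin 2 → Fin 2 → EuclideanSpace ℝ (Fin 2) → Matrix (Fin m) (Fin m) ℂ)
    (hAmeas : ∀ α β p q, Measurable fun x => Ab α β x p q)
    (M : ℝ) (hAbd : ∀ α β x p q, ‖Ab α β x p q‖ ≤ M)
    (c₁ c₂ : ℝ) (hc₁ : 0 < c₁) (hc₁₂ : c₁ < c₂)
    (hAreg : ∀ (x : EuclideanSpace ℝ (Fin 2)) (ξ : Fin 2 → Fin m → ℂ),
      c₁ * (∑ l : Fin 2, ∑ p : Fin m, ‖ξ l p‖ ^ 2) ≤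
        (∑ α : Fin 2, ∑ β : Fin 2, star ((Ab α β x).mulVec (ξ β)) ⬝ᵥ ξ α).re ∧
      (∑ α : Fin 2, ∑ β : Fin 2, star ((Ab α β x).mulVec (ξ β)) ⬝ᵥ ξ α).re ≤
        c₂ * (∑ l : Fin 2, ∑ p : Fin m, ‖ξ l p‖ ^ 2)) :
    Tendsto (fun y : EuclideanSpace ℝ (Fin 2) =>
        ∑ p : Fin 2, ∑ q : Fin 2,
          star ((pushA Fmap Gmap Ab p q y).mulVec (ξrad m y q)) ⬝ᵥ ξrad m y p)
      toS1plus (nhds (0 : ℂ)) ∧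
    Tendsto (fun y : EuclideanSpace ℝ (Fin 2) =>
        (∑ p : Fin 2, ∑ q : Fin 2,
          star ((pushA Fmap Gmap Ab p q y).mulVec (ξtan m y q)) ⬝ᵥ ξtan m y p).re)
      toS1plus atTop := by
  have hM : 0 ≤ M := (norm_nonneg _).trans (hAbd 0 0 0 ⟨0, hm⟩ ⟨0, hm⟩)
  have hnw : Tendsto (fun y : EuclideanSpace ℝ (Fin 2) => ‖y‖) toS1plus
      (nhdsWithin 1 (Set.Ioi 1)) := tendsto_comap.mono_left inf_le_right
  have hn : Tendsto (fun y : EuclideanSpace ℝ (Fin 2) => ‖y‖) toS1plus (nhds 1) :=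
    hnw.mono_right nhdsWithin_le_nhds
  have hev : ∀ᶠ y in toS1plus, 1 < ‖y‖ := hnw.eventually self_mem_nhdsWithin
  constructor
  · have hlim : Tendsto (fun y : EuclideanSpace ℝ (Fin 2) =>
        (‖y‖ - 1) / ‖y‖ * (4 * (m * (m * M)))) toS1plus (nhds 0) := by
      have := ((hn.sub_const 1).div hn one_ne_zero).mul_const (4 * (m * (m * M)))
      simpa using this
    refine squeeze_zero_norm' ?_ hlim
    filter_upwards [hev] with y hy
    rw [rad_form Ab y hy, norm_mul, Complex.norm_real,
      Real.norm_of_nonneg (div_nonneg (by linarith) (by linarith))]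
    refine mul_le_mul_of_nonneg_left ?_ (div_nonneg (by linarith) (by linarith))
    have hle : ∀ l, |y l / ‖y‖| ≤ 1 := by
      intro l
      have hs := hat_sq y hy
      rw [← sq_le_one_iff_abs_le_one]
      fin_cases l
      · exact (by nlinarith [sq_nonneg (y 1 / ‖y‖)] : (y 0 / ‖y‖) ^ 2 ≤ 1)
      · exact (by nlinarith [sq_nonneg (y 0 / ‖y‖)] : (y 1 / ‖y‖) ^ 2 ≤ 1)
    have hterm : ∀ α β, ‖(((y α / ‖y‖) * (y β / ‖y‖) : ℝ) : ℂ) * aform (Ab α β (Gmap y))‖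
        ≤ m * (m * M) := by
      intro α β
      rw [norm_mul, Complex.norm_real, Real.norm_eq_abs, abs_mul]
      have h1 := aform_bound (Ab α β (Gmap y)) M (hAbd α β _)
      have h2 : |y α / ‖y‖| * |y β / ‖y‖| ≤ 1 :=
        mul_le_one₀ (hle α) (abs_nonneg _) (hle β)
      calc _ ≤ 1 * ‖aform (Ab α β (Gmap y))‖ :=
            mul_le_mul_of_nonneg_right h2 (norm_nonneg _)
        _ ≤ _ := by rw [one_mul]; exact h1
    refine (norm_sum_le_of_le _ (n := fun _ => 2 * (m * (m * M))) ?_).trans ?_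
    · intro α _
      refine (norm_sum_le_of_le _ (fun β _ => hterm α β)).trans ?_
      simp
    · simp
      linarith
  · have hlim : Tendsto (fun y : EuclideanSpace ℝ (Fin 2) =>
        (‖y‖ - 1)⁻¹ * (c₁ * m)) toS1plus atTop := by
      have h0 : Tendsto (fun y : EuclideanSpace ℝ (Fin 2) => ‖y‖ - 1) toS1plus
          (nhdsWithin 0 (Set.Ioi 0)) := by
        refine tendsto_nhdsWithin_iff.mpr ⟨by simpa using hn.sub_const 1, ?_⟩
        filter_upwards [hev] with y hy
        exact sub_pos.mpr hy
      have hmp : (0 : ℝ) < m := by exact_mod_cast hm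
      exact (tendsto_inv_nhdsGT_zero.comp h0).atTop_mul_const (by positivity)
    refine tendsto_atTop_mono' _ ?_ hlim
    filter_upwards [hev] with y hy
    rw [tan_form Ab y hy, Complex.re_ofReal_mul]
    have h1 := (hAreg (Gmap y) (fun l _ => ((tvec y l : ℝ) : ℂ))).1
    rw [form_real] at h1
    have h2 : (∑ l : Fin 2, ∑ _p : Fin m, ‖((tvec y l : ℝ) : ℂ)‖ ^ 2) = m := by
      have hs := hat_sq y hy
      simp only [Complex.norm_real, Real.norm_eq_abs, sq_abs, Finset.sum_const,
        Finset.card_univ, Fintype.card_fin, nsmul_eq_mul, Fin.sum_univ_two, tvec]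
      simp only [if_true, one_ne_zero, if_false, neg_div, neg_sq]
      linear_combination (m : ℝ) * hs
    rw [h2] at h1
    have h3 : 0 < (‖y‖ - 1)⁻¹ := inv_pos.mpr (by linarith)
    have h4 : 0 ≤ c₁ * (m : ℝ) := by positivity
    calc (‖y‖ - 1)⁻¹ * (c₁ * m) ≤ ((‖y‖ - 1)⁻¹ + 1) * (c₁ * m) := by linarith
      _ ≤ _ := mul_le_mul_of_nonneg_left h1 (by linarith)
end
end
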